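/- Let ζ = exp(2πi/5) and φ = (1+√5)/2. For t ∈ ℂ with t ∉ {1, ζ², ζ³}, set X₁(t) = −φ·(t−ζ²)³/((t−ζ³)²·(t−1)) and Y₁(t) = −φ·(1−ζ²t)³/((1−ζ³t)²·(1−t)). Then X₁(t) ≠ 0, Y₁(t) ≠ 0, and X₁(t) + Y₁(t) + X₁(t)⁻²·Y₁(t)⁻² − 5·X₁(t)⁻¹·Y₁(t)⁻¹ + 5 = 0. Moreover X₁(0) = Y₁(0) = −φ, so the parametrization t ↦ (X₁(t), Y₁(t)) sends t = 0 to the node q₁ = (−φ, −φ). -/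

import Mathlib

/-- ζ = exp(2πi/5). -/
noncomputable def ζ5 : ℂ := Complex.exp (2 * Real.pi * Complex.I / 5)

/-- The golden ratio φ = (1+√5)/2, as a complex number. -/
noncomputable def goldφ : ℂ := (((1 + Real.sqrt 5) / 2 : ℝ) : ℂ)

/-- First uniformization, X-coordinate. -/
noncomputable def X1 (t : ℂ) : ℂ := -goldφ * (t - ζ5 ^ 2) ^ 3 / ((t - ζ5 ^ 3) ^ 2 * (t - 1))

/-- First uniformization, Y-coordinate. -/
noncomputable def Y1 (t : ℂ) : ℂ :=
  -goldφ * (1 - ζ5 ^ 2 * t) ^ 3 / ((1 - ζ5 ^ 3 * t) ^ 2 * (1 - t))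

theorem ζ5_pow_five : ζ5 ^ 5 = 1 := by
  rw [ζ5, ← Complex.exp_nat_mul, ← Complex.exp_two_pi_mul_I]
  congr 1
  push_cast
  ring

theorem ζ5_sq_add_cube : ζ5 ^ 2 + ζ5 ^ 3 = -goldφ := by
  have h2 : ζ5 ^ 2 = -Complex.exp (-(↑(Real.pi / 5) : ℂ) * Complex.I) := by
    rw [ζ5, ← Complex.exp_nat_mul, ← Complex.exp_add_pi_mul_I]
    congr 1
    push_cast
    ring
  have h3 : ζ5 ^ 3 = -Complex.exp ((↑(Real.pi / 5) : ℂ) * Complex.I) := by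
    rw [ζ5, ← Complex.exp_nat_mul, ← Complex.exp_add_pi_mul_I]
    congr 1
    push_cast
    ring
  have hc := Complex.two_cos (↑(Real.pi / 5) : ℂ)
  rw [← Complex.ofReal_cos, Real.cos_pi_div_five] at hc
  rw [h2, h3, goldφ]
  push_cast at hc ⊢
  linear_combination hc

theorem goldφ_sq : goldφ ^ 2 = goldφ + 1 := by
  have h5 : Real.sqrt 5 ^ 2 = 5 := Real.sq_sqrt (by norm_num)
  rw [goldφ]
  norm_cast
  linear_combination h5 / 4

theorem goldφ_ne_zero : goldφ ≠ 0 := by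
  intro h
  simpa [h] using goldφ_sq

theorem ζ5_ne_zero : ζ5 ≠ 0 := Complex.exp_ne_zero _

theorem Y1_eq (t : ℂ) :
    Y1 t = -goldφ * (t - ζ5 ^ 3) ^ 3 / ((t - ζ5 ^ 2) ^ 2 * (t - 1)) := by
  have hz := ζ5_pow_five
  have hA : 1 - ζ5 ^ 2 * t = -ζ5 ^ 2 * (t - ζ5 ^ 3) := by linear_combination -hz
  have hB : 1 - ζ5 ^ 3 * t = -ζ5 ^ 3 * (t - ζ5 ^ 2) := by linear_combination -hz
  have h6 : -ζ5 ^ 6 ≠ 0 := neg_ne_zero.mpr (pow_ne_zero _ ζ5_ne_zero)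
  rw [Y1, hA, hB, ← mul_div_mul_left _ ((t - ζ5 ^ 2) ^ 2 * (t - 1)) h6]
  congr 1 <;> ring

/-- The equation of the curve after clearing denominators. -/
theorem quintic_identity {t f a b : ℂ} (hf : f ^ 2 = f + 1) (hs : a + b = 2 * t + f)
    (hp : a * b = t ^ 2 + f * t + 1) :
    -f ^ 5 * (a ^ 5 + b ^ 5) + (t - 1) ^ 5 - 5 * f ^ 2 * (a * b) * (t - 1) ^ 3
      + 5 * f ^ 4 * (a * b) ^ 2 * (t - 1) = 0 := by
  have h5 : a ^ 5 + b ^ 5 = (a + b) ^ 5 - 5 * (a + b) ^ 3 * (a * b)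
      + 5 * (a + b) * (a * b) ^ 2 := by ring
  rw [h5, hs, hp]
  linear_combination (
    (-f ^ 8 - f ^ 7 + 3 * f ^ 6 + 2 * f ^ 5 + 2 * f ^ 3 - 3 * f ^ 2 - f + 1) +
    (-5 * f ^ 7 - 5 * f ^ 6 + 10 * f ^ 5 + 5 * f ^ 4 - 5 * f ^ 3 + 5 * f ^ 2 + 5 * f - 5) * t +
    (-10 * f ^ 6 - 10 * f ^ 5 + 5 * f ^ 4 + 5 * f ^ 3 - 10 * f + 10) * t ^ 2 +
    (-10 * f ^ 5 - 5 * f ^ 4 - 5 * f ^ 3 + 10 * f - 10) * t ^ 3 +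
    (-5 * f ^ 4 + 5 * f ^ 3 - 5 * f ^ 2 - 5 * f + 5) * t ^ 4 +
    (-2 * f ^ 3 + 3 * f ^ 2 + f - 1) * t ^ 5) * hf

theorem stmt_6 (t : ℂ) (h1 : t ≠ 1) (h2 : t ≠ ζ5 ^ 2) (h3 : t ≠ ζ5 ^ 3) :
    X1 t ≠ 0 ∧ Y1 t ≠ 0 ∧
      X1 t + Y1 t + ((X1 t)⁻¹) ^ 2 * ((Y1 t)⁻¹) ^ 2 - 5 * (X1 t)⁻¹ * (Y1 t)⁻¹ + 5 = 0 ∧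
      X1 0 = -goldφ ∧ Y1 0 = -goldφ := by
  have hf := goldφ_ne_zero
  have hd : t - 1 ≠ 0 := sub_ne_zero.mpr h1
  have ha : t - ζ5 ^ 2 ≠ 0 := sub_ne_zero.mpr h2
  have hb : t - ζ5 ^ 3 ≠ 0 := sub_ne_zero.mpr h3
  have key := quintic_identity (t := t) (a := t - ζ5 ^ 2) (b := t - ζ5 ^ 3) goldφ_sq
    (by linear_combination -ζ5_sq_add_cube) (by linear_combination ζ5_pow_five - t * ζ5_sq_add_cube)
  refine ⟨?_, ?_, ?_, ?_, by simp [Y1]⟩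
  · simp [X1, hf, hd, ha, hb]
  · simp [Y1_eq, hf, hd, ha, hb]
  · rw [Y1_eq, X1]
    generalize t - ζ5 ^ 2 = a at *
    generalize t - ζ5 ^ 3 = b at *
    generalize t - 1 = d at *
    field_simp
    linear_combination key
  · rw [X1, div_eq_iff (by simp [ζ5_ne_zero])]
    ring
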